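/- Let α ∈ ℂ with |Re α| < 1/2, let r ∈ (0,1), and let ξ(r) = i(1−ir)/(1+ir). Define the Wiener-Hopf factors σ_r⁺(ξ) = exp(α·(Log(ξ+ξ(r)) − Log(ξ−conj(ξ(r))))) and σ_r⁻(ξ) = exp(α·(Log(ξ−ξ(r)) − Log(ξ+conj(ξ(r))))) for real ξ. Then for every u > 0, the improper integral (1/2π)·lim_{M→∞} ∫_{−M}^{M} (σ_r⁺(ξ)/σ_r⁻(ξ) − 1) e^{iξu} dξ exists and equals i·(sin(πα)/π) · ∫_{−r}^{r} ((1+rx)(r+x)/((1−rx)(r−x)))^α · e^{iξ(x)u} · 2/(1+ix)² dx, where ξ(x) = i(1−ix)/(1+ix) and, for x ∈ (−r,r), the quantity (1+rx)(r+x)/((1−rx)(r−x)) is a positive real number and t^α denotes exp(α·ln t) for t > 0. (This identity results from deforming the contour of the Fourier integral to the arc of the unit circle between ξ(r) and −conj(ξ(r)) described in both directions.) -/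

import Mathlib

open Complex Filter Topology Real

/-- The linear-fractional map `ξ(x) = i(1−ix)/(1+ix)`, mapping `[−1,1]` onto the upper
half of the unit circle. -/
noncomputable def xiMap (x : ℝ) : ℂ :=
  Complex.I * (1 - Complex.I * x) / (1 + Complex.I * x)

/-- The Wiener-Hopf plus factor `σ_r⁺(ξ) = exp(α(Log(ξ+ξ(r)) − Log(ξ−conj ξ(r))))`. -/
noncomputable def sigmaRegPlus (α : ℂ) (r : ℝ) (t : ℝ) : ℂ :=
  Complex.exp (α * (Complex.log ((t:ℂ) + xiMap r)
    - Complex.log ((t:ℂ) - (starRingEnd ℂ) (xiMap r))))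

/-- The Wiener-Hopf minus factor `σ_r⁻(ξ) = exp(α(Log(ξ−ξ(r)) − Log(ξ+conj ξ(r))))`. -/
noncomputable def sigmaRegMinus (α : ℂ) (r : ℝ) (t : ℝ) : ℂ :=
  Complex.exp (α * (Complex.log ((t:ℂ) - xiMap r)
    - Complex.log ((t:ℂ) + (starRingEnd ℂ) (xiMap r))))

section Auxiliary

open MeasureTheory Set

/-- The power `t ^ α = exp (α log t)` of a positive real number `t`. -/
noncomputable def posPow (α : ℂ) (t : ℝ) : ℂ := Complex.exp (α * Real.log t)

lemma posPow_mul (α : ℂ) {s t : ℝ} (hs : 0 < s) (ht : 0 < t) :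
    posPow α (s * t) = posPow α s * posPow α t := by
  rw [posPow, posPow, posPow, Real.log_mul hs.ne' ht.ne', ← Complex.exp_add]
  push_cast
  ring_nf

lemma hasDerivAt_posPow (α : ℂ) {s : ℝ} (hs : 0 < s) :
    HasDerivAt (posPow α) (α * (posPow α s / s)) s := by
  have h := (((Real.hasDerivAt_log hs.ne').ofReal_comp).const_mul α).cexp
  convert! h using 1
  simp only [posPow, Complex.ofReal_inv]
  ring

lemma cpow_mul_cpow_eq_posPow (α : ℂ) {p : ℝ} (hp : p ∈ Ioo (0 : ℝ) 1) :
    (p : ℂ) ^ (1 + α - 1) * (1 - (p : ℂ)) ^ (1 - α - 1) = posPow α (p / (1 - p)) := by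
  have h1 : 0 < 1 - p := sub_pos.2 hp.2
  have e : (1 : ℂ) - p = ((1 - p : ℝ) : ℂ) := by push_cast; rfl
  rw [e, Complex.cpow_def_of_ne_zero (by exact_mod_cast hp.1.ne'),
    Complex.cpow_def_of_ne_zero (by exact_mod_cast h1.ne'), ← Complex.ofReal_log hp.1.le,
    ← Complex.ofReal_log h1.le, posPow, Real.log_div hp.1.ne' h1.ne', ← Complex.exp_add]
  push_cast
  ring_nf

lemma integrableOn_posPow_div_one_sub {α : ℂ} (hα : |α.re| < 1) :
    IntegrableOn (fun p : ℝ => posPow α (p / (1 - p))) (Ioo 0 1) := by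
  have hα' := abs_lt.1 hα
  have h := betaIntegral_convergent (u := 1 + α) (v := 1 - α)
    (by simp; linarith) (by simp; linarith)
  rw [intervalIntegrable_iff_integrableOn_Ioo_of_le zero_le_one] at h
  exact h.congr_fun (fun p hp => cpow_mul_cpow_eq_posPow α hp) measurableSet_Ioo

lemma sin_mul_integral_posPow_div_one_sub {α : ℂ} (hα : |α.re| < 1) :
    Complex.sin (π * α) * ∫ p in Ioo (0 : ℝ) 1, posPow α (p / (1 - p)) = π * α := by
  have hα' := abs_lt.1 hα
  have h1 : 0 < (1 + α).re := by simp; linarith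
  have h2 : 0 < (1 - α).re := by simp; linarith
  have hB : ∫ p in Ioo (0 : ℝ) 1, posPow α (p / (1 - p)) =
      Complex.Gamma (1 + α) * Complex.Gamma (1 - α) := by
    rw [Complex.Gamma_mul_Gamma_eq_betaIntegral h1 h2, Complex.betaIntegral,
      intervalIntegral.integral_of_le zero_le_one, integral_Ioc_eq_integral_Ioo,
      show (1 + α) + (1 - α) = 1 + 1 by ring, Complex.Gamma_add_one 1 one_ne_zero,
      Complex.Gamma_one, one_mul, one_mul]
    exact setIntegral_congr_fun measurableSet_Ioo
      fun p hp => (cpow_mul_cpow_eq_posPow α hp).symm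
  rw [hB]
  rcases eq_or_ne α 0 with rfl | h0
  · simp
  have hne : Complex.Gamma (1 + α) * Complex.Gamma (1 - α) ≠ 0 :=
    mul_ne_zero (Complex.Gamma_ne_zero_of_re_pos h1) (Complex.Gamma_ne_zero_of_re_pos h2)
  have hprod : Complex.Gamma (1 + α) * Complex.Gamma (1 - α) =
      α * (π / Complex.sin (π * α)) := by
    rw [add_comm, Complex.Gamma_add_one α h0, mul_assoc, Complex.Gamma_mul_Gamma_one_sub]
  have hs : Complex.sin (π * α) ≠ 0 := by
    intro hs
    simp [hs] at hprod
    exact hne (mul_eq_zero.2 hprod)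
  rw [hprod]
  field_simp

lemma interp_pos {s p : ℝ} (hs : 0 < s) (hp : p ∈ Ioo (0 : ℝ) 1) : 0 < p + s * (1 - p) :=
  add_pos hp.1 (mul_pos hs (sub_pos.2 hp.2))

lemma image_mobius_Ioo {s : ℝ} (hs : 0 < s) :
    (fun p : ℝ => p / (p + s * (1 - p))) '' Ioo 0 1 = Ioo 0 1 := by
  ext q
  constructor
  · rintro ⟨p, hp, rfl⟩
    have := interp_pos hs hp
    have h1 : 0 < s * (1 - p) := mul_pos hs (sub_pos.2 hp.2)
    exact ⟨div_pos hp.1 this, (div_lt_one this).2 (by linarith)⟩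
  · intro hq
    have h1 : 0 < 1 - q := sub_pos.2 hq.2
    have h2 : 0 < s * q := mul_pos hs hq.1
    have h3 : 0 < s * q + (1 - q) := by positivity
    refine ⟨s * q / (s * q + (1 - q)), ⟨by positivity, (div_lt_one h3).2 (by linarith)⟩, ?_⟩
    have : s * q / (s * q + (1 - q)) + s * (1 - s * q / (s * q + (1 - q)))
        = s / (s * q + (1 - q)) := by
      field_simp
      ring
    simp only [this]
    field_simp

lemma injOn_mobius_Ioo {s : ℝ} (hs : 0 < s) :
    InjOn (fun p : ℝ => p / (p + s * (1 - p))) (Ioo 0 1) := by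
  intro p hp q hq h
  have h1 := interp_pos hs hp
  have h2 := interp_pos hs hq
  simp only at h
  rw [div_eq_div_iff h1.ne' h2.ne'] at h
  have : s * (p - q) = 0 := by linear_combination h
  rcases mul_eq_zero.1 this with h | h <;> linarith

lemma integral_posPow_div_sq (α : ℂ) {s : ℝ} (hs : 0 < s) :
    ∫ p in Ioo (0 : ℝ) 1, posPow α (p / (1 - p)) * (((p + s * (1 - p)) ^ 2)⁻¹ : ℝ) =
      posPow α s / s * ∫ p in Ioo (0 : ℝ) 1, posPow α (p / (1 - p)) := by
  have hder : ∀ p ∈ Ioo (0 : ℝ) 1, HasDerivWithinAt (fun p : ℝ => p / (p + s * (1 - p)))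
      (s / (p + s * (1 - p)) ^ 2) (Ioo 0 1) p := by
    intro p hp
    have h1 := (interp_pos hs hp).ne'
    have h2 : HasDerivAt (fun p : ℝ => p + s * (1 - p)) (1 + s * (0 - 1)) p :=
      (hasDerivAt_id p).add (((hasDerivAt_const p (1 : ℝ)).sub (hasDerivAt_id p)).const_mul s)
    convert! ((hasDerivAt_id p).div h2 h1).hasDerivWithinAt using 1
    simp only [id]
    ring
  have key := integral_image_eq_integral_abs_deriv_smul measurableSet_Ioo hder
    (injOn_mobius_Ioo hs) (fun q => posPow α (q / (1 - q)))
  rw [image_mobius_Ioo hs] at key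
  rw [key, ← integral_const_mul]
  refine setIntegral_congr_fun measurableSet_Ioo fun p hp => ?_
  have h1 := interp_pos hs hp
  have h2 : 0 < 1 - p := sub_pos.2 hp.2
  have hp0 := hp.1
  have e : p / (p + s * (1 - p)) / (1 - p / (p + s * (1 - p))) = p / (1 - p) / s := by
    rw [one_sub_div h1.ne']
    field_simp
    ring_nf
  have e2 : posPow α (p / (1 - p)) = posPow α s * posPow α (p / (1 - p) / s) := by
    rw [← posPow_mul α hs (by positivity)]
    congr 1
    field_simp
  simp only [e]
  rw [e2, abs_of_pos (by positivity), Complex.real_smul]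
  have hsc : (s : ℂ) ≠ 0 := by exact_mod_cast hs.ne'
  push_cast
  field_simp

/-- Joint integrability of an integrable weight times a bounded kernel. -/
lemma integrable_mul_kernel {S T : Set ℝ} (hS : MeasurableSet S) (hT : MeasurableSet T)
    (hTfin : volume T < ⊤) {g : ℝ → ℂ} (hg : IntegrableOn g S) {k : ℝ × ℝ → ℂ}
    (hk : Measurable k) {C : ℝ} (hC : ∀ x ∈ S, ∀ t ∈ T, ‖k (t, x)‖ ≤ C) :
    Integrable (fun z : ℝ × ℝ => k z * g z.2)
      ((volume.restrict T).prod (volume.restrict S)) := by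
  have : IsFiniteMeasure (volume.restrict T) := ⟨by simpa using hTfin⟩
  have h1 : Integrable (fun z : ℝ × ℝ => (1 : ℂ) * g z.2)
      ((volume.restrict T).prod (volume.restrict S)) :=
    (integrable_const (1 : ℂ)).mul_prod hg
  simp only [one_mul] at h1
  refine h1.bdd_mul (c := C) hk.aestronglyMeasurable ?_
  rw [Measure.prod_restrict]
  filter_upwards [ae_restrict_mem (hT.prod hS)] with z hz
  exact hC z.2 hz.2 z.1 hz.1

/-- The Stieltjes representation of `s ^ α - 1`. -/
lemma posPow_sub_one {α : ℂ} (hα : |α.re| < 1) {s : ℝ} (hs : 0 < s) :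
    posPow α s - 1 = Complex.sin (π * α) / π *
      ∫ p in Ioo (0 : ℝ) 1, posPow α (p / (1 - p)) * ((s - 1) / (p + s * (1 - p)) : ℝ) := by
  have hpos : ∀ σ ∈ uIcc 1 s, 0 < σ := fun σ hσ =>
    lt_of_lt_of_le (lt_min one_pos hs) hσ.1
  have hcont : ContinuousOn (fun σ : ℝ => posPow α σ / σ) (uIcc 1 s) := by
    intro σ hσ
    have h0 := hpos σ hσ
    refine ((hasDerivAt_posPow α h0).continuousAt.div
      Complex.continuous_ofReal.continuousAt ?_).continuousWithinAt
    exact_mod_cast h0.ne'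
  have hFTC : posPow α s - 1 = ∫ σ in (1 : ℝ)..s, α * (posPow α σ / σ) := by
    rw [intervalIntegral.integral_eq_sub_of_hasDerivAt
      (fun σ hσ => hasDerivAt_posPow α (hpos σ hσ))
      ((continuousOn_const.mul hcont).intervalIntegrable)]
    simp [posPow]
  have hint := integrable_mul_kernel (S := Ioo 0 1) (T := uIoc 1 s)
    (g := fun p : ℝ => posPow α (p / (1 - p)))
    (k := fun z : ℝ × ℝ => ((((z.2 + z.1 * (1 - z.2)) ^ 2)⁻¹ : ℝ) : ℂ))
    (C := ((min 1 s) ^ 2)⁻¹) measurableSet_Ioo measurableSet_uIoc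
    (by simp [uIoc]) (integrableOn_posPow_div_one_sub hα) (by fun_prop) (by
      intro p hp σ hσ
      have hm : 0 < min 1 s := lt_min one_pos hs
      have h1 : min 1 s ≤ p + σ * (1 - p) := by
        have h2 : min 1 s ≤ σ := hσ.1.le
        have h3 : min 1 s ≤ 1 := min_le_left _ _
        nlinarith [hp.1, hp.2, mul_nonneg (sub_nonneg.2 h2) (sub_nonneg.2 hp.2.le),
          mul_nonneg (sub_nonneg.2 h3) hp.1.le]
      rw [Complex.norm_real, Real.norm_of_nonneg (by positivity)]
      gcongr)
  have hswap := intervalIntegral_integral_swap (μ := volume.restrict (Ioo (0 : ℝ) 1))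
    (a := 1) (b := s)
    (f := fun σ p => ((((p + σ * (1 - p)) ^ 2)⁻¹ : ℝ) : ℂ) * posPow α (p / (1 - p))) hint
  have hleft : ∫ σ in (1 : ℝ)..s, ∫ p in Ioo (0 : ℝ) 1,
      ((((p + σ * (1 - p)) ^ 2)⁻¹ : ℝ) : ℂ) * posPow α (p / (1 - p)) =
      (∫ σ in (1 : ℝ)..s, posPow α σ / σ) * ∫ p in Ioo (0 : ℝ) 1, posPow α (p / (1 - p)) := by
    rw [← intervalIntegral.integral_mul_const]
    refine intervalIntegral.integral_congr fun σ hσ => ?_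
    rw [← integral_posPow_div_sq α (hpos σ hσ)]
    simp only [mul_comm]
  have hright : ∫ p in Ioo (0 : ℝ) 1, (∫ σ in (1 : ℝ)..s,
      ((((p + σ * (1 - p)) ^ 2)⁻¹ : ℝ) : ℂ) * posPow α (p / (1 - p))) =
      ∫ p in Ioo (0 : ℝ) 1, posPow α (p / (1 - p)) * ((s - 1) / (p + s * (1 - p)) : ℝ) := by
    refine setIntegral_congr_fun measurableSet_Ioo fun p hp => ?_
    have hinner : ∫ σ in (1 : ℝ)..s, ((p + σ * (1 - p)) ^ 2)⁻¹ =
        (s - 1) / (p + s * (1 - p)) := by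
      rw [intervalIntegral.integral_eq_sub_of_hasDerivAt
        (f := fun σ => (σ - 1) / (p + σ * (1 - p)))]
      · simp
      · intro σ hσ
        have h1 := (interp_pos (hpos σ hσ) hp).ne'
        have h2 : HasDerivAt (fun σ : ℝ => p + σ * (1 - p)) (1 * (1 - p)) σ :=
          ((hasDerivAt_id σ).mul_const (1 - p)).const_add p
        convert! ((hasDerivAt_id σ).sub_const 1).div h2 h1 using 1
        simp only [id]
        field_simp
        ring
      · refine ContinuousOn.intervalIntegrable fun σ hσ => ?_
        have h1 := (interp_pos (hpos σ hσ) hp).ne'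
        exact ContinuousAt.continuousWithinAt (by fun_prop (disch := positivity))
    rw [intervalIntegral.integral_mul_const, intervalIntegral.integral_ofReal, hinner, mul_comm]
  have hB := sin_mul_integral_posPow_div_one_sub hα
  have hπ : (π : ℂ) ≠ 0 := by exact_mod_cast Real.pi_ne_zero
  rw [← hright, ← hswap, hleft, hFTC, intervalIntegral.integral_const_mul]
  rw [mul_left_comm, div_mul_eq_mul_div, hB, mul_div_cancel_left₀ _ hπ, mul_comm]

lemma integrableOn_mul_cexp_neg {c : ℂ} (hc : 0 < c.re) :
    IntegrableOn (fun v : ℝ => (v : ℂ) * Complex.exp (-c * v)) (Ioi 0) := by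
  have h := integrableOn_rpow_mul_exp_neg_mul_rpow (p := 1) (s := 1) (by norm_num) one_pos hc
  refine Integrable.mono' h (by fun_prop) ?_
  filter_upwards [ae_restrict_mem measurableSet_Ioi] with v hv
  have hv0 : (0 : ℝ) < v := hv
  simp [Complex.norm_exp, abs_of_pos hv0]

lemma integral_mul_cexp_neg {c : ℂ} (hc : 0 < c.re) :
    ∫ v in Ioi (0 : ℝ), (v : ℂ) * Complex.exp (-c * v) = (c ^ 2)⁻¹ := by
  have hc0 : c ≠ 0 := by
    rintro rfl
    simp at hc
  have hder : ∀ v ∈ Ici (0 : ℝ), HasDerivAt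
      (fun v : ℝ => -((v : ℂ) / c + (c ^ 2)⁻¹) * Complex.exp (-c * v))
      ((v : ℂ) * Complex.exp (-c * v)) v := by
    intro v _
    have h1 : HasDerivAt (fun v : ℝ => (v : ℂ)) 1 v := (hasDerivAt_id v).ofReal_comp
    convert! (((h1.div_const c).add_const ((c ^ 2)⁻¹)).neg).mul ((h1.const_mul (-c)).cexp) using 1
    simp only [Pi.neg_apply]
    field_simp
    ring
  have hexp : Tendsto (fun v : ℝ => Complex.exp (-c * v)) atTop (𝓝 0) := by
    rw [tendsto_zero_iff_norm_tendsto_zero]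
    have h := Real.tendsto_pow_mul_exp_neg_atTop_nhds_zero 0
    have h2 := h.comp (tendsto_id.const_mul_atTop hc)
    refine h2.congr fun v => ?_
    simp [Complex.norm_exp]
  have hvexp : Tendsto (fun v : ℝ => (v : ℂ) * Complex.exp (-c * v)) atTop (𝓝 0) := by
    rw [tendsto_zero_iff_norm_tendsto_zero]
    have h := (Real.tendsto_pow_mul_exp_neg_atTop_nhds_zero 1).comp (tendsto_id.const_mul_atTop hc)
    have h2 := h.const_mul (c.re⁻¹)
    rw [mul_zero] at h2
    refine h2.congr' ?_
    filter_upwards [eventually_gt_atTop 0] with v hv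
    simp [Complex.norm_exp, abs_of_pos hv]
    field_simp
  have hlim : Tendsto (fun v : ℝ => -((v : ℂ) / c + (c ^ 2)⁻¹) * Complex.exp (-c * v))
      atTop (𝓝 0) := by
    have := ((hvexp.const_mul (-c⁻¹)).add (hexp.const_mul (-(c ^ 2)⁻¹)))
    simp only [mul_zero, add_zero] at this
    refine this.congr fun v => ?_
    ring
  rw [integral_Ioi_of_hasDerivAt_of_tendsto' hder (integrableOn_mul_cexp_neg hc) hlim]
  simp

lemma abs_im_le_norm_sub (ξ : ℂ) (t : ℝ) : |ξ.im| ≤ ‖(t : ℂ) - ξ‖ := by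
  simpa using Complex.abs_im_le_norm ((t : ℂ) - ξ)

lemma ofReal_sub_ne_zero {ξ : ℂ} (hξ : ξ.im ≠ 0) (t : ℝ) : (t : ℂ) - ξ ≠ 0 :=
  norm_pos_iff.1 ((abs_pos.2 hξ).trans_le (abs_im_le_norm_sub ξ t))

lemma integrable_inv_sq_add_sq {b : ℝ} (hb : 0 < b) :
    Integrable (fun t : ℝ => (b ^ 2 + t ^ 2)⁻¹) := by
  have h := ((integrable_inv_one_add_sq).comp_div hb.ne').const_mul (b ^ 2)⁻¹
  refine h.congr (ae_of_all _ fun t => ?_)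
  simp only
  field_simp

lemma norm_inv_sub_sq_le {ξ : ℂ} {b : ℝ} (hb : 0 < b) (hξ : b ≤ |ξ.im|) (t : ℝ) :
    ‖(((t : ℂ) - ξ) ^ 2)⁻¹‖ ≤ (b ^ 2 + (t - ξ.re) ^ 2)⁻¹ := by
  have h : b ^ 2 ≤ ξ.im ^ 2 := by
    rw [← sq_abs ξ.im]
    gcongr
  rw [norm_inv, norm_pow, ← Complex.normSq_eq_norm_sq, Complex.normSq_apply]
  refine inv_anti₀ (by positivity) ?_
  simp
  nlinarith

lemma integrable_inv_sub_sq {ξ : ℂ} (hξ : ξ.im ≠ 0) :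
    Integrable (fun t : ℝ => (((t : ℂ) - ξ) ^ 2)⁻¹) := by
  have hb := abs_pos.2 hξ
  exact Integrable.mono' ((integrable_inv_sq_add_sq hb).comp_sub_right ξ.re)
    (by fun_prop) (ae_of_all _ (norm_inv_sub_sq_le hb le_rfl))

lemma norm_cexp_I_mul (t v : ℝ) : ‖Complex.exp (I * t * v)‖ = 1 := by
  rw [show I * (t : ℂ) * v = ((t * v : ℝ) : ℂ) * I by push_cast; ring,
    Complex.norm_exp_ofReal_mul_I]

lemma integrable_cexp_mul_inv_sub_sq {ξ : ℂ} (hξ : ξ.im ≠ 0) (v : ℝ) :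
    Integrable (fun t : ℝ => Complex.exp (I * t * v) * (((t : ℂ) - ξ) ^ 2)⁻¹) :=
  (integrable_inv_sub_sq hξ).bdd_mul (c := 1) (by fun_prop)
    (ae_of_all _ fun t => (norm_cexp_I_mul t v).le)

lemma integral_cexp_mul_inv_sub_sq {ξ : ℂ} (hξ : 0 < ξ.im) {v : ℝ} (hv : v ≠ 0) :
    ∫ t : ℝ, Complex.exp (I * t * v) * (((t : ℂ) - ξ) ^ 2)⁻¹ =
      if 0 < v then -2 * π * v * Complex.exp (I * ξ * v) else 0 := by
  set f : ℝ → ℂ := (Ioi 0).indicator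
    (fun y : ℝ => (y : ℂ) * Complex.exp (-(-(2 * π * I * ξ)) * y)) with hf
  have hπ : (π : ℂ) ≠ 0 := by exact_mod_cast Real.pi_ne_zero
  have hfi : Integrable f := by
    rw [hf, integrable_indicator_iff measurableSet_Ioi]
    refine integrableOn_mul_cexp_neg ?_
    simp
    positivity
  have hFf : FourierTransform.fourier f =
      fun w : ℝ => ((2 * π * I) ^ 2)⁻¹ * (((w : ℂ) - ξ) ^ 2)⁻¹ := by
    ext w
    rw [Real.fourier_real_eq_integral_exp_smul, ← mul_inv, ← mul_pow, mul_sub]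
    rw [← integral_mul_cexp_neg (c := 2 * π * I * w - 2 * π * I * ξ)
      (by simp; positivity), ← integral_indicator measurableSet_Ioi]
    congr 1
    ext y
    by_cases hy : y ∈ Ioi (0 : ℝ)
    · simp only [hf, indicator_of_mem hy, smul_eq_mul]
      rw [mul_left_comm, ← Complex.exp_add]
      congr 2
      push_cast
      ring
    · simp [hf, indicator_of_notMem hy]
  have hFfi : Integrable (FourierTransform.fourier f) := by
    rw [hFf]
    exact (integrable_inv_sub_sq hξ.ne').const_mul _
  have hvne : v / (2 * π) ≠ 0 := by positivity
  have hcont : ContinuousAt f (v / (2 * π)) := by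
    rcases lt_or_gt_of_ne hvne with h | h
    · refine (continuousAt_const (y := (0 : ℂ))).congr ?_
      filter_upwards [Iio_mem_nhds h] with y hy
      have : y ∉ Ioi (0 : ℝ) := fun h => lt_asymm (mem_Iio.1 hy) (mem_Ioi.1 h)
      simp [hf, indicator_of_notMem this]
    · refine ContinuousAt.congr
        (f := fun y : ℝ => (y : ℂ) * Complex.exp (-(-(2 * π * I * ξ)) * y)) (by fun_prop) ?_
      filter_upwards [Ioi_mem_nhds h] with y hy
      simp [hf, indicator_of_mem hy]
  have hinv := hfi.fourierInv_fourier_eq hFfi hcont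
  rw [Real.fourierInv_eq', hFf] at hinv
  have hint : ∫ t : ℝ, Complex.exp (I * t * v) * (((t : ℂ) - ξ) ^ 2)⁻¹ =
      (2 * π * I) ^ 2 * f (v / (2 * π)) := by
    rw [← hinv, ← integral_const_mul]
    congr 1
    ext t
    have e : (((2 * π * inner ℝ t (v / (2 * π)) : ℝ) : ℂ)) * I = I * t * v := by
      simp
      field_simp
    rw [e, smul_eq_mul]
    have : ((2 : ℂ) * π * I) ≠ 0 := by simp [hπ]
    field_simp
  rw [hint]
  split_ifs with h
  · have : v / (2 * π) ∈ Ioi (0 : ℝ) := by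
      simp only [mem_Ioi]
      positivity
    simp only [hf, indicator_of_mem this]
    push_cast
    rw [show -(-(2 * (π : ℂ) * I * ξ)) * ((v : ℂ) / (2 * π)) = I * ξ * v by field_simp]
    field_simp
    simp
  · have : v / (2 * π) ∉ Ioi (0 : ℝ) := by
      simp only [mem_Ioi, not_lt]
      exact div_nonpos_of_nonpos_of_nonneg (not_lt.1 h) (by positivity)
    simp [hf, indicator_of_notMem this]

lemma integral_cexp_mul_inv_sub_sq_of_im_neg {ξ : ℂ} (hξ : ξ.im < 0) {v : ℝ} (hv : 0 < v) :
    ∫ t : ℝ, Complex.exp (I * t * v) * (((t : ℂ) - ξ) ^ 2)⁻¹ = 0 := by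
  have h := integral_cexp_mul_inv_sub_sq (ξ := -ξ) (by simpa using hξ) (neg_ne_zero.2 hv.ne')
  rw [if_neg (by linarith)] at h
  rw [← h, ← integral_neg_eq_self]
  congr 1
  ext t
  push_cast
  congr 2 <;> ring_nf

/-- The truncated Fourier integral of the simple pole `1 / (t - ξ)`. -/
noncomputable def poleIntegral (u : ℝ) (ξ : ℂ) (M : ℝ) : ℂ :=
  ∫ t in (-M)..M, Complex.exp (I * t * u) * ((t : ℂ) - ξ)⁻¹

lemma poleIntegral_eq {u : ℝ} (hu : 0 < u) {ξ : ℂ} (hξ : ξ.im ≠ 0) (M : ℝ) :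
    poleIntegral u ξ M = (I * u)⁻¹ * (Complex.exp (I * M * u) * ((M : ℂ) - ξ)⁻¹
      - Complex.exp (I * (-M : ℝ) * u) * (((-M : ℝ) : ℂ) - ξ)⁻¹
      + ∫ t in (-M)..M, Complex.exp (I * t * u) * (((t : ℂ) - ξ) ^ 2)⁻¹) := by
  have hu0 : (u : ℂ) ≠ 0 := by exact_mod_cast hu.ne'
  have hder : ∀ t ∈ uIcc (-M) M, HasDerivAt
      (fun t : ℝ => Complex.exp (I * t * u) * ((t : ℂ) - ξ)⁻¹)
      (I * u * (Complex.exp (I * t * u) * ((t : ℂ) - ξ)⁻¹)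
        - Complex.exp (I * t * u) * (((t : ℂ) - ξ) ^ 2)⁻¹) t := by
    intro t _
    have h0 := ofReal_sub_ne_zero hξ t
    have h1 : HasDerivAt (fun v : ℝ => (v : ℂ)) 1 t := (hasDerivAt_id t).ofReal_comp
    convert! (((h1.const_mul I).mul_const (u : ℂ)).cexp).mul ((h1.sub_const ξ).fun_inv h0) using 1
    field_simp
    ring
  have hi1 : IntervalIntegrable (fun t : ℝ => Complex.exp (I * t * u) * ((t : ℂ) - ξ)⁻¹)
      volume (-M) M :=
    (Continuous.mul (by fun_prop) ((Continuous.sub (by fun_prop) (by fun_prop)).inv₀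
      (ofReal_sub_ne_zero hξ))).intervalIntegrable _ _
  have hi2 : IntervalIntegrable (fun t : ℝ => Complex.exp (I * t * u) * (((t : ℂ) - ξ) ^ 2)⁻¹)
      volume (-M) M := (integrable_cexp_mul_inv_sub_sq hξ u).intervalIntegrable
  have h := intervalIntegral.integral_eq_sub_of_hasDerivAt hder ((hi1.const_mul (I * u)).sub hi2)
  rw [intervalIntegral.integral_sub (hi1.const_mul (I * u)) hi2,
    intervalIntegral.integral_const_mul] at h
  rw [← h, poleIntegral, sub_add_cancel, inv_mul_cancel_left₀ (by simp [hu0])]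

lemma exists_norm_poleIntegral_le {u : ℝ} (hu : 0 < u) {b : ℝ} (hb : 0 < b) :
    ∃ C : ℝ, ∀ ξ : ℂ, b ≤ |ξ.im| → ∀ M : ℝ, 0 ≤ M → ‖poleIntegral u ξ M‖ ≤ C := by
  refine ⟨u⁻¹ * (b⁻¹ + b⁻¹ + ∫ t : ℝ, (b ^ 2 + t ^ 2)⁻¹), fun ξ hξ M hM => ?_⟩
  have hξ0 : ξ.im ≠ 0 := abs_pos.1 (hb.trans_le hξ)
  have hbd : ∀ t : ℝ, ‖Complex.exp (I * t * u) * ((t : ℂ) - ξ)⁻¹‖ ≤ b⁻¹ := by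
    intro t
    rw [norm_mul, norm_cexp_I_mul, one_mul, norm_inv]
    gcongr
    exact hξ.trans (abs_im_le_norm_sub ξ t)
  rw [poleIntegral_eq hu hξ0, norm_mul]
  have hn : ‖(I * (u : ℂ))⁻¹‖ = u⁻¹ := by simp [abs_of_pos hu]
  rw [hn]
  gcongr
  refine (norm_add_le _ _).trans (add_le_add ((norm_sub_le _ _).trans
    (add_le_add (hbd M) (hbd (-M)))) ?_)
  rw [intervalIntegral.integral_of_le (by linarith),
    ← integral_sub_right_eq_self (fun t : ℝ => (b ^ 2 + t ^ 2)⁻¹) ξ.re]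
  have hI := (integrable_inv_sq_add_sq hb).comp_sub_right ξ.re
  refine (norm_integral_le_of_norm_le hI.integrableOn (ae_of_all _ fun t => ?_)).trans
    (setIntegral_le_integral hI (ae_of_all _ fun t => by positivity))
  rw [norm_mul, norm_cexp_I_mul, one_mul]
  exact norm_inv_sub_sq_le hb hξ t

lemma tendsto_cexp_mul_inv_sub {ι : Type*} {l : Filter ι} {φ : ι → ℝ} (ξ : ℂ) (u : ℝ)
    (hφ : Tendsto (fun i => |φ i|) l atTop) :
    Tendsto (fun i => Complex.exp (I * φ i * u) * ((φ i : ℂ) - ξ)⁻¹) l (𝓝 0) := by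
  have h : Tendsto (fun i => (|φ i| + (-‖ξ‖))⁻¹) l (𝓝 0) :=
    tendsto_inv_atTop_zero.comp (tendsto_atTop_add_const_right _ _ hφ)
  refine squeeze_zero_norm' ?_ h
  filter_upwards [hφ.eventually_gt_atTop ‖ξ‖] with i hi
  rw [norm_mul, norm_cexp_I_mul, one_mul, norm_inv]
  have := norm_sub_norm_le (φ i : ℂ) ξ
  rw [Complex.norm_real, Real.norm_eq_abs] at this
  exact inv_anti₀ (by linarith) (by linarith)

lemma tendsto_poleIntegral {u : ℝ} (hu : 0 < u) {ξ : ℂ} (hξ : ξ.im ≠ 0) :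
    Tendsto (poleIntegral u ξ) atTop
      (𝓝 ((I * u)⁻¹ * ∫ t : ℝ, Complex.exp (I * t * u) * (((t : ℂ) - ξ) ^ 2)⁻¹)) := by
  have h1 := tendsto_cexp_mul_inv_sub (φ := fun M : ℝ => M) ξ u tendsto_abs_atTop_atTop
  have h2 := tendsto_cexp_mul_inv_sub (φ := fun M : ℝ => -M) ξ u
    (by simpa using tendsto_abs_atTop_atTop)
  have h3 := intervalIntegral_tendsto_integral (integrable_cexp_mul_inv_sub_sq hξ u)
    tendsto_neg_atTop_atBot tendsto_id
  have h := ((h1.sub h2).add h3).const_mul (I * (u : ℂ))⁻¹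
  rw [sub_zero, zero_add] at h
  exact h.congr fun M => (poleIntegral_eq hu hξ M).symm

lemma tendsto_poleIntegral_of_im_pos {u : ℝ} (hu : 0 < u) {ξ : ℂ} (hξ : 0 < ξ.im) :
    Tendsto (poleIntegral u ξ) atTop (𝓝 (2 * π * I * Complex.exp (I * ξ * u))) := by
  convert tendsto_poleIntegral hu hξ.ne' using 2
  have hu0 : (u : ℂ) ≠ 0 := by exact_mod_cast hu.ne'
  rw [integral_cexp_mul_inv_sub_sq hξ hu.ne', if_pos hu]
  field_simp
  simp

lemma tendsto_poleIntegral_of_im_neg {u : ℝ} (hu : 0 < u) {ξ : ℂ} (hξ : ξ.im < 0) :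
    Tendsto (poleIntegral u ξ) atTop (𝓝 0) := by
  convert tendsto_poleIntegral hu hξ.ne using 2
  rw [integral_cexp_mul_inv_sub_sq_of_im_neg hξ hu, mul_zero]
lemma one_add_I_mul_ne_zero (x : ℝ) : 1 + I * (x : ℂ) ≠ 0 := fun h => by
  simpa using congrArg Complex.re h

lemma one_sub_I_mul_ne_zero (x : ℝ) : 1 - I * (x : ℂ) ≠ 0 := fun h => by
  simpa using congrArg Complex.re h

lemma xiMap_eq (x : ℝ) :
    xiMap x = (2 * x / (1 + x ^ 2) : ℝ) + ((1 - x ^ 2) / (1 + x ^ 2) : ℝ) * I := by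
  have h1 := one_add_I_mul_ne_zero x
  have h2 : (1 : ℂ) + (x : ℂ) ^ 2 ≠ 0 := by
    have : (1 + x ^ 2 : ℝ) ≠ 0 := by positivity
    exact_mod_cast this
  rw [xiMap, div_eq_iff h1]
  push_cast
  field_simp
  ring_nf
  simp only [I_sq]
  ring

lemma xiMap_re (x : ℝ) : (xiMap x).re = 2 * x / (1 + x ^ 2) := by
  rw [xiMap_eq]
  simp only [Complex.add_re, Complex.ofReal_re, Complex.re_ofReal_mul, Complex.I_re, mul_zero,
    add_zero]

lemma xiMap_im (x : ℝ) : (xiMap x).im = (1 - x ^ 2) / (1 + x ^ 2) := by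
  rw [xiMap_eq]
  simp only [Complex.add_im, Complex.ofReal_im, Complex.im_ofReal_mul, Complex.I_im, mul_one,
    zero_add]

lemma log_add_log_conj {z : ℂ} (hz : z.im ≠ 0) :
    Complex.log z + Complex.log ((starRingEnd ℂ) z) = Real.log (Complex.normSq z) := by
  rw [Complex.log_conj z fun h => hz (Complex.arg_eq_pi_iff.1 h).2, Complex.add_conj,
    Complex.log_re, Complex.normSq_eq_norm_sq, Real.log_pow]
  norm_num

lemma quadratic_pos {r : ℝ} (hr0 : 0 < r) (hr1 : r < 1) (t : ℝ) :
    0 < t ^ 2 + 4 * r / (1 + r ^ 2) * t + 1 ∧ 0 < t ^ 2 - 4 * r / (1 + r ^ 2) * t + 1 := by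
  have h1 : 4 * r / (1 + r ^ 2) < 2 := by
    rw [div_lt_iff₀ (by positivity)]
    nlinarith [sq_pos_of_pos (sub_pos.2 hr1)]
  have h0 : 0 < 4 * r / (1 + r ^ 2) := by positivity
  constructor <;> nlinarith [sq_nonneg (t + 2 * r / (1 + r ^ 2)), sq_nonneg (t + 1),
    sq_nonneg (t - 1)]

lemma sigmaRegPlus_div_sigmaRegMinus (α : ℂ) {r : ℝ} (hr0 : 0 < r) (hr1 : r < 1) (t : ℝ) :
    sigmaRegPlus α r t / sigmaRegMinus α r t =
      posPow α ((t ^ 2 + 4 * r / (1 + r ^ 2) * t + 1) /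
        (t ^ 2 - 4 * r / (1 + r ^ 2) * t + 1)) := by
  obtain ⟨hp, hm⟩ := quadratic_pos hr0 hr1 t
  have him : (xiMap r).im ≠ 0 := by
    rw [xiMap_im]
    have : 0 < 1 - r ^ 2 := by nlinarith
    positivity
  have h1 := log_add_log_conj (z := (t : ℂ) + xiMap r) (by simpa using him)
  have h2 := log_add_log_conj (z := (t : ℂ) - xiMap r) (by simpa using him)
  have n1 : Complex.normSq ((t : ℂ) + xiMap r) = t ^ 2 + 4 * r / (1 + r ^ 2) * t + 1 := by
    rw [Complex.normSq_apply]
    simp only [Complex.add_re, Complex.add_im, Complex.ofReal_re, Complex.ofReal_im, xiMap_re,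
      xiMap_im]
    field_simp
    ring
  have n2 : Complex.normSq ((t : ℂ) - xiMap r) = t ^ 2 - 4 * r / (1 + r ^ 2) * t + 1 := by
    rw [Complex.normSq_apply]
    simp only [Complex.sub_re, Complex.sub_im, Complex.ofReal_re, Complex.ofReal_im, xiMap_re,
      xiMap_im]
    field_simp
    ring
  rw [n1] at h1
  rw [n2] at h2
  simp only [map_add, map_sub, Complex.conj_ofReal] at h1 h2
  rw [sigmaRegPlus, sigmaRegMinus, ← Complex.exp_sub, posPow, Real.log_div hp.ne' hm.ne']
  congr 1
  push_cast
  rw [← h1, ← h2]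
  ring

/-- The argument of the power on the arc, as a function of the arc parameter. -/
noncomputable def arcRatio (r x : ℝ) : ℝ := (1 + r * x) * (r + x) / ((1 - r * x) * (r - x))

/-- The change of variables from the arc parameter to the beta-integral variable. -/
noncomputable def arcParam (r x : ℝ) : ℝ := (1 + r * x) * (r + x) / (2 * r * (1 + x ^ 2))

/-- The derivative of `arcParam`. -/
noncomputable def arcParamDeriv (r x : ℝ) : ℝ :=
  (1 + r ^ 2) * (1 - x ^ 2) / (2 * r * (1 + x ^ 2) ^ 2)


lemma arc_factors_pos {r : ℝ} (hr0 : 0 < r) (hr1 : r < 1) {x : ℝ} (hx : x ∈ Ioo (-r) r) :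
    0 < 1 + r * x ∧ 0 < r + x ∧ 0 < 1 - r * x ∧ 0 < r - x ∧ 0 < 1 - x ^ 2 ∧ x ^ 2 < r ^ 2 := by
  have h1 := hx.1
  have h2 := hx.2
  have h3 : x ^ 2 < r ^ 2 := by nlinarith
  refine ⟨?_, ?_, ?_, ?_, ?_, h3⟩ <;> nlinarith

lemma arcRatio_pos {r : ℝ} (hr0 : 0 < r) (hr1 : r < 1) {x : ℝ} (hx : x ∈ Ioo (-r) r) :
    0 < arcRatio r x := by
  obtain ⟨h1, h2, h3, h4, -⟩ := arc_factors_pos hr0 hr1 hx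
  unfold arcRatio
  positivity

lemma one_sub_arcParam {r : ℝ} (hr0 : 0 < r) (x : ℝ) :
    1 - arcParam r x = (1 - r * x) * (r - x) / (2 * r * (1 + x ^ 2)) := by
  unfold arcParam
  field_simp
  ring

lemma arcParam_div_one_sub {r : ℝ} (hr0 : 0 < r) (x : ℝ) :
    arcParam r x / (1 - arcParam r x) = arcRatio r x := by
  rw [one_sub_arcParam hr0, arcParam, arcRatio, div_div_div_cancel_right₀ (by positivity)]

lemma hasDerivAt_arcParam {r : ℝ} (hr0 : 0 < r) (x : ℝ) :
    HasDerivAt (arcParam r) (arcParamDeriv r x) x := by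
  have hid := hasDerivAt_id x
  have hnum := ((hid.const_mul r).const_add 1).mul (hid.const_add r)
  have hden := (((hasDerivAt_pow 2 x).const_add 1).const_mul (2 * r))
  convert! hnum.div hden (by positivity) using 1
  simp only [arcParamDeriv, id, Pi.mul_apply]
  field_simp
  ring

lemma image_arcParam {r : ℝ} (hr0 : 0 < r) (hr1 : r < 1) :
    arcParam r '' Ioo (-r) r = Ioo 0 1 := by
  apply Subset.antisymm
  · rintro _ ⟨x, hx, rfl⟩
    obtain ⟨h1, h2, h3, h4, -⟩ := arc_factors_pos hr0 hr1 hx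
    refine ⟨by unfold arcParam; positivity, sub_pos.1 ?_⟩
    rw [one_sub_arcParam hr0]
    positivity
  · have h := intermediate_value_Ioo (by linarith : -r ≤ r) (f := arcParam r)
      fun x _ => (hasDerivAt_arcParam hr0 x).continuousAt.continuousWithinAt
    have e0 : arcParam r (-r) = 0 := by simp [arcParam]
    have e1 : arcParam r r = 1 := by
      unfold arcParam
      field_simp
      ring
    rwa [e0, e1] at h

lemma injOn_arcParam {r : ℝ} (hr0 : 0 < r) (hr1 : r < 1) :
    InjOn (arcParam r) (Ioo (-r) r) := by
  intro x hx y hy h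
  unfold arcParam at h
  rw [div_eq_div_iff (by positivity) (by positivity)] at h
  have h1 : (2 * r * (1 + r ^ 2) * (1 - x * y)) * (x - y) = 0 := by linear_combination h
  have hxy : 0 < 1 - x * y := by
    have := (arc_factors_pos hr0 hr1 hx).2.2.2.2.1
    have := (arc_factors_pos hr0 hr1 hy).2.2.2.2.1
    nlinarith [sq_nonneg (x - y)]
  have h2 : 2 * r * (1 + r ^ 2) * (1 - x * y) ≠ 0 := by positivity
  exact sub_eq_zero.1 ((mul_eq_zero.1 h1).resolve_left h2)

lemma arcParamDeriv_pos {r : ℝ} (hr0 : 0 < r) (hr1 : r < 1) {x : ℝ} (hx : x ∈ Ioo (-r) r) :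
    0 < arcParamDeriv r x := by
  have := (arc_factors_pos hr0 hr1 hx).2.2.2.2.1
  unfold arcParamDeriv
  positivity

lemma integrableOn_posPow_arcRatio {α : ℂ} (hα : |α.re| < 1) {r : ℝ} (hr0 : 0 < r)
    (hr1 : r < 1) : IntegrableOn (fun x => posPow α (arcRatio r x)) (Ioo (-r) r) := by
  have h := (integrableOn_image_iff_integrableOn_abs_deriv_smul measurableSet_Ioo
    (fun x _ => (hasDerivAt_arcParam hr0 x).hasDerivWithinAt) (injOn_arcParam hr0 hr1)
    (fun p => posPow α (p / (1 - p)))).1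
    (by rw [image_arcParam hr0 hr1]; exact integrableOn_posPow_div_one_sub hα)
  have hmeas : Measurable fun x => (((arcParamDeriv r x)⁻¹ : ℝ) : ℂ) := by
    unfold arcParamDeriv
    fun_prop
  have hb := h.bdd_mul (f := fun x => (((arcParamDeriv r x)⁻¹ : ℝ) : ℂ))
    (c := 8 * r / (1 - r ^ 2)) hmeas.aestronglyMeasurable (by
      filter_upwards [ae_restrict_mem measurableSet_Ioo] with x hx
      have hpos := arcParamDeriv_pos hr0 hr1 hx
      obtain ⟨-, -, -, -, h5, h6⟩ := arc_factors_pos hr0 hr1 hx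
      rw [Complex.norm_real, Real.norm_of_nonneg (inv_pos.2 hpos).le, arcParamDeriv, inv_div]
      have h7 : (1 + x ^ 2) ^ 2 ≤ 4 := by nlinarith [sq_nonneg x]
      apply div_le_div₀ (by positivity) (by nlinarith) (by nlinarith)
      nlinarith [mul_pos (sq_pos_of_pos hr0) h5])
  refine hb.congr ?_
  filter_upwards [ae_restrict_mem measurableSet_Ioo] with x hx
  have hpos := arcParamDeriv_pos hr0 hr1 hx
  rw [arcParam_div_one_sub hr0, abs_of_pos hpos, Complex.real_smul, ← mul_assoc,
    ← Complex.ofReal_mul, inv_mul_cancel₀ hpos.ne', Complex.ofReal_one, one_mul]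

/-- The derivative `2 / (1 + I x) ^ 2` of `xiMap`. -/
noncomputable def xiDeriv (x : ℝ) : ℂ := 2 / (1 + I * x) ^ 2

/-- The sum of the pole contributions at `ξ(x)` and at its conjugate. -/
noncomputable def poleSum (t x : ℝ) : ℂ :=
  xiDeriv x * ((t : ℂ) - xiMap x)⁻¹ +
    (starRingEnd ℂ) (xiDeriv x) * ((t : ℂ) - (starRingEnd ℂ) (xiMap x))⁻¹

lemma norm_xiDeriv_le (x : ℝ) : ‖xiDeriv x‖ ≤ 2 := by
  have h : 1 ≤ ‖1 + I * (x : ℂ)‖ := by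
    simpa using Complex.re_le_norm (1 + I * (x : ℂ))
  rw [xiDeriv, norm_div, norm_pow, Complex.norm_ofNat]
  exact div_le_self zero_le_two (one_le_pow₀ h)

lemma poleSum_eq (t : ℝ) {x : ℝ} (hx : x ^ 2 < 1) :
    poleSum t x = (4 * t * (1 - x ^ 2) /
      ((1 + x ^ 2) * (t ^ 2 * (1 + x ^ 2) - 4 * x * t + 1 + x ^ 2)) : ℝ) := by
  have h1 := one_add_I_mul_ne_zero x
  have h2 := one_sub_I_mul_ne_zero x
  have him : (xiMap x).im ≠ 0 := by
    rw [xiMap_im]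
    have : 0 < 1 - x ^ 2 := by linarith
    positivity
  have h3 := ofReal_sub_ne_zero him t
  have h4 : (t : ℂ) - (starRingEnd ℂ) (xiMap x) ≠ 0 :=
    ofReal_sub_ne_zero (by simpa using him) t
  have hξ : xiMap x = (x + I) / (1 + I * x) := by
    rw [xiMap]
    congr 1
    linear_combination -(x : ℂ) * I_sq
  have hc : (starRingEnd ℂ) (xiMap x) = (x - I) / (1 - I * x) := by
    simp only [hξ, map_div₀, map_add, map_mul, map_one, Complex.conj_I, Complex.conj_ofReal]
    ring
  have hdc : (starRingEnd ℂ) (xiDeriv x) = 2 / (1 - I * x) ^ 2 := by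
    simp only [xiDeriv, map_div₀, map_pow, map_add, map_mul, map_one, Complex.conj_I,
      Complex.conj_ofReal, map_ofNat]
    ring
  have e1 : (t : ℂ) - (x + I) / (1 + I * x) = (t * (1 + I * x) - (x + I)) / (1 + I * x) := by
    rw [eq_div_iff h1, sub_mul, div_mul_cancel₀ _ h1]
  have e2 : (t : ℂ) - (x - I) / (1 - I * x) = (t * (1 - I * x) - (x - I)) / (1 - I * x) := by
    rw [eq_div_iff h2, sub_mul, div_mul_cancel₀ _ h2]
  have e3 : (1 : ℂ) + x ^ 2 = (1 + I * x) * (1 - I * x) := by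
    linear_combination (x : ℂ) ^ 2 * I_sq
  have e4 : (t : ℂ) ^ 2 * (1 + x ^ 2) - 4 * x * t + 1 + x ^ 2 =
      (t * (1 + I * x) - (x + I)) * (t * (1 - I * x) - (x - I)) := by
    linear_combination ((t : ℂ) ^ 2 * x ^ 2 - 2 * x * t + 1) * I_sq
  have e5 : 2 * t * (1 - (x : ℂ) ^ 2) = (1 - I * x) * (t * (1 - I * x) - (x - I)) +
      (1 + I * x) * (t * (1 + I * x) - (x + I)) := by
    linear_combination (-2 * (t : ℂ) * x ^ 2 + 2 * x) * I_sq
  rw [hξ, e1] at h3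
  rw [hc, e2] at h4
  have h5 := (div_ne_zero_iff.1 h3).1
  have h6 := (div_ne_zero_iff.1 h4).1
  rw [poleSum, hc, hdc, hξ, xiDeriv, e1, e2]
  push_cast
  rw [e4, e3, show 4 * (t : ℂ) * (1 - (x : ℂ) ^ 2) = 2 * (2 * t * (1 - (x : ℂ) ^ 2)) by ring, e5]
  clear e1 e2 e3 e4 e5 h3 h4
  generalize (t : ℂ) * (1 + I * x) - (x + I) = N₁ at *
  generalize (t : ℂ) * (1 - I * x) - (x - I) = N₂ at *
  generalize 1 + I * (x : ℂ) = A at *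
  generalize 1 - I * (x : ℂ) = B at *
  field_simp

lemma posPow_ratio_sub_one {α : ℂ} (hα : |α.re| < 1) {r : ℝ} (hr0 : 0 < r) (hr1 : r < 1)
    (t : ℝ) :
    posPow α ((t ^ 2 + 4 * r / (1 + r ^ 2) * t + 1) /
        (t ^ 2 - 4 * r / (1 + r ^ 2) * t + 1)) - 1 =
      Complex.sin (π * α) / π * ∫ x in Ioo (-r) r, poleSum t x * posPow α (arcRatio r x) := by
  obtain ⟨hp, hm⟩ := quadratic_pos hr0 hr1 t
  rw [posPow_sub_one hα (div_pos hp hm), ← image_arcParam hr0 hr1,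
    integral_image_eq_integral_abs_deriv_smul measurableSet_Ioo
      (fun x _ => (hasDerivAt_arcParam hr0 x).hasDerivWithinAt) (injOn_arcParam hr0 hr1)]
  congr 1
  refine setIntegral_congr_fun measurableSet_Ioo fun x hx => ?_
  obtain ⟨-, -, -, -, h5, h6⟩ := arc_factors_pos hr0 hr1 hx
  rw [arcParam_div_one_sub hr0, abs_of_pos (arcParamDeriv_pos hr0 hr1 hx), Complex.real_smul,
    poleSum_eq t (by linarith), mul_left_comm, ← Complex.ofReal_mul, mul_comm]
  congr 2
  have hD : 0 < t ^ 2 * (1 + x ^ 2) - 4 * x * t + 1 + x ^ 2 := by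
    nlinarith [sq_nonneg (t - x), sq_nonneg (t * x - 1), sq_nonneg (t * x + 1),
      sq_nonneg (t + x), mul_nonneg (sq_nonneg t) (sq_nonneg x), sq_nonneg (t - 1),
      sq_nonneg (t + 1), sq_nonneg (x * t - x), sq_nonneg (x * t + x)]
  set c := 4 * r / (1 + r ^ 2) with hc
  have hN : (t ^ 2 - c * t + 1) ≠ 0 := hm.ne'
  have hcx : 2 * c * (1 - arcParam r x) * (1 + x ^ 2) = c * (1 + x ^ 2) - 4 * x := by
    rw [one_sub_arcParam hr0, hc]
    field_simp
    ring
  have hcd : c * arcParamDeriv r x * (1 + x ^ 2) ^ 2 = 2 * (1 - x ^ 2) := by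
    rw [arcParamDeriv, hc]
    field_simp
    ring
  clear_value c
  have hnum : t ^ 2 + c * t + 1 = (t ^ 2 - c * t + 1) + 2 * c * t := by ring
  have hDN : t ^ 2 * (1 + x ^ 2) - 4 * x * t + 1 + x ^ 2 =
      (1 + x ^ 2) * (t ^ 2 - c * t + 1 + c * t) - 4 * x * t := by ring
  have hlin : (arcParam r x + (t ^ 2 + c * t + 1) / (t ^ 2 - c * t + 1) * (1 - arcParam r x)) *
      ((1 + x ^ 2) * (t ^ 2 - c * t + 1)) =
      t ^ 2 * (1 + x ^ 2) - 4 * x * t + 1 + x ^ 2 := by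
    rw [hDN, hnum]
    generalize t ^ 2 - c * t + 1 = N at hN
    field_simp
    linear_combination t * hcx
  rw [← eq_div_iff (by positivity)] at hlin
  rw [hlin, hnum]
  generalize arcParamDeriv r x = d at *
  generalize t ^ 2 - c * t + 1 = N at *
  generalize t ^ 2 * (1 + x ^ 2) - 4 * x * t + 1 + x ^ 2 = D at *
  field_simp
  linear_combination 2 * t * hcd

lemma le_abs_im_xiMap {r : ℝ} (hr0 : 0 < r) (hr1 : r < 1) {x : ℝ} (hx : x ∈ Ioo (-r) r) :
    (1 - r ^ 2) / (1 + r ^ 2) ≤ (xiMap x).im := by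
  have h6 := (arc_factors_pos hr0 hr1 hx).2.2.2.2.2
  rw [xiMap_im, div_le_div_iff₀ (by positivity) (by positivity)]
  nlinarith

lemma norm_poleSum_le {r : ℝ} (hr0 : 0 < r) (hr1 : r < 1) {x : ℝ} (hx : x ∈ Ioo (-r) r) (t : ℝ) :
    ‖poleSum t x‖ ≤ 4 * ((1 - r ^ 2) / (1 + r ^ 2))⁻¹ := by
  have hδ : 0 < (1 - r ^ 2) / (1 + r ^ 2) := div_pos (by nlinarith) (by positivity)
  have him := le_abs_im_xiMap hr0 hr1 hx
  have hinv {ξ : ℂ} (h : (1 - r ^ 2) / (1 + r ^ 2) ≤ |ξ.im|) :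
      ‖((t : ℂ) - ξ)⁻¹‖ ≤ ((1 - r ^ 2) / (1 + r ^ 2))⁻¹ := by
    rw [norm_inv]
    exact inv_anti₀ hδ (h.trans (abs_im_le_norm_sub ξ t))
  have h1 := hinv (him.trans (le_abs_self _))
  have h2 := hinv (ξ := (starRingEnd ℂ) (xiMap x)) (by
    rw [Complex.conj_im, abs_neg]
    exact him.trans (le_abs_self _))
  have h3 := norm_xiDeriv_le x
  calc ‖poleSum t x‖ ≤ ‖xiDeriv x‖ * ‖((t : ℂ) - xiMap x)⁻¹‖ +
        ‖xiDeriv x‖ * ‖((t : ℂ) - (starRingEnd ℂ) (xiMap x))⁻¹‖ := by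
        refine (norm_add_le _ _).trans_eq ?_
        rw [norm_mul, norm_mul, RCLike.norm_conj]
    _ ≤ 2 * ((1 - r ^ 2) / (1 + r ^ 2))⁻¹ + 2 * ((1 - r ^ 2) / (1 + r ^ 2))⁻¹ := by gcongr
    _ = 4 * ((1 - r ^ 2) / (1 + r ^ 2))⁻¹ := by ring

lemma measurable_xiMap : Measurable xiMap := by
  unfold xiMap
  fun_prop

lemma measurable_xiDeriv : Measurable xiDeriv := by
  unfold xiDeriv
  fun_prop

lemma measurable_poleSum : Measurable fun z : ℝ × ℝ => poleSum z.1 z.2 := by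
  have h1 : Measurable fun z : ℝ × ℝ => xiMap z.2 := measurable_xiMap.comp measurable_snd
  have h2 : Measurable fun z : ℝ × ℝ => xiDeriv z.2 := measurable_xiDeriv.comp measurable_snd
  have h3 : Measurable fun z : ℝ × ℝ => (z.1 : ℂ) := by fun_prop
  have hc : Measurable (starRingEnd ℂ) := Complex.continuous_conj.measurable
  exact (h2.mul (h3.sub h1).inv).add ((hc.comp h2).mul (h3.sub (hc.comp h1)).inv)

/-- The symmetric truncation of the Fourier integral of `poleSum · x`. -/
noncomputable def poleSumIntegral (u M x : ℝ) : ℂ :=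
  xiDeriv x * poleIntegral u (xiMap x) M +
    (starRingEnd ℂ) (xiDeriv x) * poleIntegral u ((starRingEnd ℂ) (xiMap x)) M

lemma integral_poleSum {x : ℝ} (him : (xiMap x).im ≠ 0) (u M : ℝ) :
    ∫ t in (-M)..M, cexp (I * t * u) * poleSum t x = poleSumIntegral u M x := by
  have hi {ξ : ℂ} (h : ξ.im ≠ 0) : IntervalIntegrable
      (fun t : ℝ => cexp (I * t * u) * ((t : ℂ) - ξ)⁻¹) volume (-M) M := by
    apply Continuous.intervalIntegrable
    exact (by fun_prop : Continuous fun t : ℝ => cexp (I * t * u)).mul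
      (Continuous.inv₀ (by fun_prop) (ofReal_sub_ne_zero h))
  have h1 := (hi him).const_mul (xiDeriv x)
  have h2 := (hi (ξ := (starRingEnd ℂ) (xiMap x)) (by simpa using him)).const_mul
    ((starRingEnd ℂ) (xiDeriv x))
  rw [poleSumIntegral, poleIntegral, poleIntegral, ← intervalIntegral.integral_const_mul,
    ← intervalIntegral.integral_const_mul, ← intervalIntegral.integral_add h1 h2]
  congr 1 with t
  rw [poleSum]
  ring

lemma integrable_kernel_mul_posPow {α : ℂ} (hα : |α.re| < 1) {r : ℝ} (hr0 : 0 < r) (hr1 : r < 1)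
    (u M : ℝ) :
    Integrable (fun z : ℝ × ℝ => cexp (I * z.1 * u) * poleSum z.1 z.2 * posPow α (arcRatio r z.2))
      ((volume.restrict (uIoc (-M) M)).prod (volume.restrict (Ioo (-r) r))) := by
  refine integrable_mul_kernel (k := fun z => cexp (I * z.1 * u) * poleSum z.1 z.2)
    measurableSet_Ioo measurableSet_uIoc ?_ (integrableOn_posPow_arcRatio hα hr0 hr1)
    ((by fun_prop : Measurable fun z : ℝ × ℝ => cexp (I * z.1 * u)).mul measurable_poleSum)
    (C := 4 * ((1 - r ^ 2) / (1 + r ^ 2))⁻¹) fun x hx t _ => ?_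
  · rw [uIoc]
    exact measure_Ioc_lt_top
  · rw [norm_mul, norm_cexp_I_mul, one_mul]
    exact norm_poleSum_le hr0 hr1 hx t

lemma im_xiMap_pos {r : ℝ} (hr0 : 0 < r) (hr1 : r < 1) {x : ℝ} (hx : x ∈ Ioo (-r) r) :
    0 < (xiMap x).im :=
  (div_pos (by nlinarith) (by positivity)).trans_le (le_abs_im_xiMap hr0 hr1 hx)

lemma aestronglyMeasurable_poleSumIntegral_mul {α : ℂ} (hα : |α.re| < 1) {r : ℝ} (hr0 : 0 < r)
    (hr1 : r < 1) (u : ℝ) {M : ℝ} (hM : 0 ≤ M) :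
    AEStronglyMeasurable (fun x => poleSumIntegral u M x * posPow α (arcRatio r x))
      (volume.restrict (Ioo (-r) r)) := by
  refine (integrable_kernel_mul_posPow hα hr0 hr1 u M).integral_prod_right.aestronglyMeasurable.congr
    ?_
  filter_upwards [ae_restrict_mem measurableSet_Ioo] with x hx
  rw [integral_mul_const, uIoc_of_le (by linarith), ← intervalIntegral.integral_of_le (by linarith),
    integral_poleSum (im_xiMap_pos hr0 hr1 hx).ne']

/-- The truncated Fourier integral written as an integral over the arc parameter. -/
lemma integral_sigmaReg_eq {α : ℂ} (hα : |α.re| < 1) {r : ℝ} (hr0 : 0 < r) (hr1 : r < 1)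
    (u : ℝ) {M : ℝ} (hM : 0 ≤ M) :
    ∫ t in (-M)..M, (sigmaRegPlus α r t / sigmaRegMinus α r t - 1) * cexp (I * t * u) =
      Complex.sin (π * α) / π *
        ∫ x in Ioo (-r) r, poleSumIntegral u M x * posPow α (arcRatio r x) := by
  have hle : -M ≤ M := by linarith
  have hint := integrable_kernel_mul_posPow hα hr0 hr1 u M
  rw [uIoc_of_le hle] at hint
  calc ∫ t in (-M)..M, (sigmaRegPlus α r t / sigmaRegMinus α r t - 1) * cexp (I * t * u)
      = ∫ t in Ioc (-M) M, Complex.sin (π * α) / π *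
          ∫ x in Ioo (-r) r, cexp (I * t * u) * poleSum t x * posPow α (arcRatio r x) := by
        rw [intervalIntegral.integral_of_le hle]
        congr 1 with t
        rw [sigmaRegPlus_div_sigmaRegMinus α hr0 hr1, posPow_ratio_sub_one hα hr0 hr1, mul_assoc,
          ← integral_mul_const]
        congr 2 with x
        ring
    _ = Complex.sin (π * α) / π * ∫ x in Ioo (-r) r, ∫ t in Ioc (-M) M,
          cexp (I * t * u) * poleSum t x * posPow α (arcRatio r x) := by
        rw [integral_const_mul, integral_integral_swap hint]
    _ = _ := by
        congr 1
        refine setIntegral_congr_fun measurableSet_Ioo fun x hx => ?_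
        rw [integral_mul_const, ← intervalIntegral.integral_of_le hle,
          integral_poleSum (im_xiMap_pos hr0 hr1 hx).ne']

lemma tendsto_integral_poleSumIntegral_mul {α : ℂ} (hα : |α.re| < 1) {r : ℝ} (hr0 : 0 < r)
    (hr1 : r < 1) {u : ℝ} (hu : 0 < u) :
    Tendsto (fun M => ∫ x in Ioo (-r) r, poleSumIntegral u M x * posPow α (arcRatio r x)) atTop
      (𝓝 (∫ x in Ioo (-r) r,
        xiDeriv x * (2 * π * I * cexp (I * xiMap x * u)) * posPow α (arcRatio r x))) := by
  obtain ⟨C, hC⟩ := exists_norm_poleIntegral_le hu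
    (div_pos (by nlinarith) (by positivity) : 0 < (1 - r ^ 2) / (1 + r ^ 2))
  refine tendsto_integral_filter_of_dominated_convergence
    (fun x => 4 * C * ‖posPow α (arcRatio r x)‖) ?_ ?_
    ((integrableOn_posPow_arcRatio hα hr0 hr1).norm.const_mul _) ?_
  · filter_upwards [eventually_ge_atTop 0] with M hM
    exact aestronglyMeasurable_poleSumIntegral_mul hα hr0 hr1 u hM
  · filter_upwards [eventually_ge_atTop 0] with M hM
    filter_upwards [ae_restrict_mem measurableSet_Ioo] with x hx
    have him := (le_abs_im_xiMap hr0 hr1 hx).trans (le_abs_self _)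
    have h1 := hC (xiMap x) him M hM
    have h2 := hC ((starRingEnd ℂ) (xiMap x)) (by rwa [Complex.conj_im, abs_neg]) M hM
    have h3 := norm_xiDeriv_le x
    have h4 := (norm_nonneg _).trans h1
    rw [norm_mul]
    gcongr
    calc ‖poleSumIntegral u M x‖ ≤ ‖xiDeriv x‖ * ‖poleIntegral u (xiMap x) M‖ +
          ‖xiDeriv x‖ * ‖poleIntegral u ((starRingEnd ℂ) (xiMap x)) M‖ := by
          refine (norm_add_le _ _).trans_eq ?_
          rw [norm_mul, norm_mul, RCLike.norm_conj]
      _ ≤ 2 * C + 2 * C := by gcongr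
      _ = 4 * C := by ring
  · filter_upwards [ae_restrict_mem measurableSet_Ioo] with x hx
    have him := im_xiMap_pos hr0 hr1 hx
    have h1 := (tendsto_poleIntegral_of_im_pos hu him).const_mul (xiDeriv x)
    have h2 := (tendsto_poleIntegral_of_im_neg hu (ξ := (starRingEnd ℂ) (xiMap x))
      (by simpa using him)).const_mul ((starRingEnd ℂ) (xiDeriv x))
    simpa only [poleSumIntegral, mul_zero, add_zero] using
      (h1.add h2).mul_const (posPow α (arcRatio r x))

end Auxiliary

/-- **Contour deformation of the Fourier integral of `σ_r⁺/σ_r⁻ − 1`.**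
For `|Re α| < 1/2`, `r ∈ (0,1)` and `u > 0`, the improper integral
`(1/2π) lim_{M→∞} ∫_{−M}^{M} (σ_r⁺(ξ)/σ_r⁻(ξ) − 1) e^{iξu} dξ` exists and equals
`i (sin πα / π) ∫_{−r}^{r} ((1+rx)(r+x)/((1−rx)(r−x)))^α e^{iξ(x)u} · 2/(1+ix)² dx`;
moreover `(1+rx)(r+x)/((1−rx)(r−x)) > 0` for `x ∈ (−r,r)`. -/
theorem sigmaReg_fourier_contour_deformation
    (α : ℂ) (hα : |α.re| < 1 / 2) (r : ℝ) (hr0 : 0 < r) (hr1 : r < 1)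
    (u : ℝ) (hu : 0 < u) :
    (∀ x ∈ Set.Ioo (-r) r, 0 < (1 + r * x) * (r + x) / ((1 - r * x) * (r - x))) ∧
    Tendsto
      (fun M : ℝ => (1 / (2 * (π:ℂ))) *
        ∫ t in (-M)..M,
          (sigmaRegPlus α r t / sigmaRegMinus α r t - 1) * Complex.exp (Complex.I * t * u))
      atTop
      (nhds (Complex.I * (Complex.sin ((π:ℂ) * α) / (π:ℂ)) *
        ∫ x in (-r)..r,
          Complex.exp (α * Real.log ((1 + r * x) * (r + x) / ((1 - r * x) * (r - x))))
            * Complex.exp (Complex.I * xiMap x * u) * (2 / (1 + Complex.I * x) ^ 2))) := by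
  have hα' : |α.re| < 1 := by linarith
  refine ⟨fun x hx => arcRatio_pos hr0 hr1 hx, ?_⟩
  have hlim := ((tendsto_integral_poleSumIntegral_mul hα' hr0 hr1 hu).const_mul
    (Complex.sin (π * α) / π)).const_mul (1 / (2 * (π : ℂ)))
  have hval : Complex.I * (Complex.sin ((π:ℂ) * α) / (π:ℂ)) * ∫ x in (-r)..r,
      Complex.exp (α * Real.log ((1 + r * x) * (r + x) / ((1 - r * x) * (r - x))))
        * Complex.exp (Complex.I * xiMap x * u) * (2 / (1 + Complex.I * x) ^ 2) =
      1 / (2 * (π : ℂ)) * (Complex.sin (π * α) / π * ∫ x in Set.Ioo (-r) r,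
        xiDeriv x * (2 * π * Complex.I * Complex.exp (Complex.I * xiMap x * u)) *
          posPow α (arcRatio r x)) := by
    have hπ : (π : ℂ) ≠ 0 := Complex.ofReal_ne_zero.2 Real.pi_ne_zero
    rw [intervalIntegral.integral_of_le (by linarith), MeasureTheory.integral_Ioc_eq_integral_Ioo,
      ← MeasureTheory.integral_const_mul, ← MeasureTheory.integral_const_mul,
      ← MeasureTheory.integral_const_mul]
    congr 1 with x
    simp only [posPow, arcRatio, xiDeriv]
    field_simp
  rw [hval]
  refine hlim.congr' ?_
  filter_upwards [eventually_ge_atTop 0] with M hM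
  rw [integral_sigmaReg_eq hα' hr0 hr1 u hM]
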